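/- The class of basic feasible functionals is closed under functional substitution: if H(g⃗,f⃗,x⃗) and G₁(f⃗,x⃗,y), …, G_l(f⃗,x⃗,y) are basic feasible functionals, then the functional F defined by F(f⃗,x⃗) = H(λy.G₁(f⃗,x⃗,y), …, λy.G_l(f⃗,x⃗,y), f⃗, x⃗) is also a basic feasible functional. -/

import Mathlib

/-- The smash function: `x # y = 2^(|x|·|y|)`, where `|x| = Nat.size x` is the binary length. -/
def smash (x y : ℕ) : ℕ := 2 ^ (Nat.size x * Nat.size y)

/-- The class BFF of basic feasible functionals.  A type 2 functional of rank `(k,l)` is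
represented as a map `(Fin k → ℕ → ℕ) → (Fin l → ℕ) → ℕ`. -/
inductive BFF : (k l : ℕ) → ((Fin k → ℕ → ℕ) → (Fin l → ℕ) → ℕ) → Prop
  | zero : BFF 0 1 (fun _ _ => 0)
  | s0 : BFF 0 1 (fun _ x => 2 * x 0)
  | s1 : BFF 0 1 (fun _ x => 2 * x 0 + 1)
  | proj (n : ℕ) (i : Fin n) : BFF 0 n (fun _ x => x i)
  | smashF : BFF 0 2 (fun _ x => smash (x 0) (x 1))
  | ap : BFF 1 1 (fun f x => f 0 (x 0))
  | expansion {k l k' l' : ℕ} (ρ : Fin k → Fin k') (σ : Fin l → Fin l')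
      (hρ : Function.Injective ρ) (hσ : Function.Injective σ)
      {G : (Fin k → ℕ → ℕ) → (Fin l → ℕ) → ℕ} (hG : BFF k l G) :
      BFF k' l' (fun f x => G (fun i => f (ρ i)) (fun j => x (σ j)))
  | comp {k l m : ℕ} {H : (Fin k → ℕ → ℕ) → (Fin (m + l) → ℕ) → ℕ}
      {G : Fin m → (Fin k → ℕ → ℕ) → (Fin l → ℕ) → ℕ}
      (hH : BFF k (m + l) H) (hG : ∀ i, BFF k l (G i)) :
      BFF k l (fun f x => H f (Fin.append (fun i => G i f x) x))
  | lrn {k l : ℕ} (F : (Fin k → ℕ → ℕ) → (Fin (l + 1) → ℕ) → ℕ)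
      {G : (Fin k → ℕ → ℕ) → (Fin l → ℕ) → ℕ}
      {H₁ H₂ : (Fin k → ℕ → ℕ) → (Fin (l + 2) → ℕ) → ℕ}
      {K : (Fin k → ℕ → ℕ) → (Fin (l + 1) → ℕ) → ℕ}
      (hG : BFF k l G) (hH₁ : BFF k (l + 2) H₁) (hH₂ : BFF k (l + 2) H₂)
      (hK : BFF k (l + 1) K)
      (hbase : ∀ f x, F f (Fin.snoc x 0) = G f x)
      (heven : ∀ f x y, 0 < y →
        F f (Fin.snoc x (2 * y)) = H₁ f (Fin.snoc (Fin.snoc x y) (F f (Fin.snoc x y))))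
      (hodd : ∀ f x y,
        F f (Fin.snoc x (2 * y + 1)) = H₂ f (Fin.snoc (Fin.snoc x y) (F f (Fin.snoc x y))))
      (hbound : ∀ f x, Nat.size (F f x) ≤ Nat.size (K f x)) :
      BFF k (l + 1) F

theorem BFF.proj' (k : ℕ) {l : ℕ} (i : Fin l) : BFF k l (fun _ x => x i) :=
  BFF.expansion (k' := k) (fun j : Fin 0 => j.elim0) (id : Fin l → Fin l)
    (fun a => a.elim0) Function.injective_id (BFF.proj l i)

theorem BFF.comp' {k l m : ℕ} {H : (Fin k → ℕ → ℕ) → (Fin m → ℕ) → ℕ}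
    {G : Fin m → (Fin k → ℕ → ℕ) → (Fin l → ℕ) → ℕ}
    (hH : BFF k m H) (hG : ∀ i, BFF k l (G i)) :
    BFF k l (fun f x => H f (fun i => G i f x)) := by
  have h := BFF.comp (BFF.expansion (id : Fin k → Fin k) (Fin.castAdd l : Fin m → Fin (m + l))
    Function.injective_id (Fin.castAdd_injective m l) hH) hG
  simpa using h

theorem BFF.reindex {k l m : ℕ} {H : (Fin k → ℕ → ℕ) → (Fin m → ℕ) → ℕ}
    (hH : BFF k m H) (σ : Fin m → Fin l) :
    BFF k l (fun f x => H f (fun i => x (σ i))) :=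
  BFF.comp' hH (fun i => BFF.proj' k (σ i))

theorem BFF.lift0 {l : ℕ} {H : (Fin 0 → ℕ → ℕ) → (Fin l → ℕ) → ℕ} (hH : BFF 0 l H) (k p : ℕ)
    (g : (Fin k → ℕ → ℕ) → (Fin (p + l) → ℕ) → Fin 0 → ℕ → ℕ) :
    BFF k (p + l) (fun f x => H (g f x) (fun j => x (Fin.natAdd p j))) := by
  have h := BFF.expansion (k' := k) (fun j : Fin 0 => j.elim0) (Fin.natAdd p : Fin l → Fin (p + l))
    (fun a => a.elim0) (Fin.natAdd_injective l p) hH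
  convert h using 4

theorem snoc_castAdd_aux (p l : ℕ) (x : Fin (p + l) → ℕ) (y : ℕ) :
    (fun j : Fin p => (Fin.snoc x y : Fin (p + l + 1) → ℕ) (Fin.castAdd (l + 1) j))
      = fun j => x (Fin.castAdd l j) := by
  funext j
  exact Fin.snoc_castSucc (α := fun _ => ℕ) y x (Fin.castAdd l j)

theorem snoc_natAdd_aux (p l : ℕ) (x : Fin (p + l) → ℕ) (y : ℕ) :
    (fun j : Fin (l + 1) => (Fin.snoc x y : Fin (p + l + 1) → ℕ) (Fin.natAdd p j))
      = Fin.snoc (fun j => x (Fin.natAdd p j)) y := by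
  funext j
  refine Fin.lastCases ?_ (fun j => ?_) j
  · rw [Fin.snoc_last]
    exact Fin.snoc_last (α := fun _ => ℕ) y x
  · rw [Fin.snoc_castSucc]
    exact Fin.snoc_castSucc (α := fun _ => ℕ) y x (Fin.natAdd p j)

theorem BFF.subst_aux {k l : ℕ} {H : (Fin k → ℕ → ℕ) → (Fin l → ℕ) → ℕ} (hH : BFF k l H) :
    ∀ (k' p : ℕ) (G : Fin k → (Fin k' → ℕ → ℕ) → (Fin (p + 1) → ℕ) → ℕ)
      (_ : ∀ i, BFF k' (p + 1) (G i)),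
      BFF k' (p + l) (fun f x =>
        H (fun i y => G i f (Fin.snoc (fun j => x (Fin.castAdd l j)) y))
          (fun j => x (Fin.natAdd p j))) := by
  induction hH with
  | zero => intro k' p G hG; exact BFF.lift0 BFF.zero k' p (fun _ _ i => i.elim0)
  | s0 => intro k' p G hG; exact BFF.lift0 BFF.s0 k' p (fun _ _ i => i.elim0)
  | s1 => intro k' p G hG; exact BFF.lift0 BFF.s1 k' p (fun _ _ i => i.elim0)
  | proj n i => intro k' p G hG; exact BFF.lift0 (BFF.proj n i) k' p (fun _ _ i => i.elim0)
  | smashF => intro k' p G hG; exact BFF.lift0 BFF.smashF k' p (fun _ _ i => i.elim0)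
  | ap =>
    intro k' p G hG
    convert hG 0 using 3 with f x
    exact congrArg (G 0 f) (Fin.snoc_init_self x)
  | @expansion k l k₁ l₁ ρ σ hρ hσ G₀ hG₀ ih =>
    intro k' p G hG
    have h := BFF.reindex (ih k' p (fun i => G (ρ i)) (fun i => hG _))
      (Fin.addCases (fun j => Fin.castAdd l₁ j) (fun j => Fin.natAdd p (σ j)) :
        Fin (p + l) → Fin (p + l₁))
    simpa using h
  | @comp k l m H₀ G₀ hH₀ hG₀ ihH ihG =>
    intro k' p G hG
    have h := BFF.comp' (l := p + l)
      (G := Fin.addCases (fun j => fun _ x => x (Fin.castAdd l j))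
        (Fin.addCases (fun i => fun f x => G₀ i
            (fun i y => G i f (Fin.snoc (fun j => x (Fin.castAdd l j)) y))
            (fun j => x (Fin.natAdd p j)))
          (fun j => fun _ x => x (Fin.natAdd p j))))
      (ihH k' p G hG) (by
        intro i
        refine Fin.addCases (fun j => ?_) (fun j => ?_) i
        · simpa using BFF.proj' k' (Fin.castAdd l j)
        · refine Fin.addCases (fun j => ?_) (fun j => ?_) j
          · simpa using ihG j k' p G hG
          · simpa using BFF.proj' k' (Fin.natAdd p j))
    convert h using 3 with f x
    refine congrArg₂ H₀ (by simp) (funext fun j => ?_)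
    refine Fin.addCases (fun j => ?_) (fun j => ?_) j <;> simp
  | @lrn k l F G₀ H₁ H₂ K hG₀ hH₁ hH₂ hK hbase heven hodd hbound ihG ih₁ ih₂ ihK =>
    intro k' p G hG
    refine BFF.lrn (l := p + l) _ (ihG k' p G hG) (ih₁ k' p G hG) (ih₂ k' p G hG)
      (ihK k' p G hG) ?_ ?_ ?_ ?_
    · intro f x
      simp only [snoc_castAdd_aux, snoc_natAdd_aux, hbase]
    · intro f x y hy
      have e1 := snoc_castAdd_aux p (l + 1) (Fin.snoc x y)
      simp only [snoc_castAdd_aux, snoc_natAdd_aux, heven _ _ y hy]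
      erw [e1, snoc_castAdd_aux]
    · intro f x y
      have e1 := snoc_castAdd_aux p (l + 1) (Fin.snoc x y)
      simp only [snoc_castAdd_aux, snoc_natAdd_aux, hodd _ _ y]
      erw [e1, snoc_castAdd_aux]
    · intro f x
      exact hbound _ _

/-- The class of basic feasible functionals is closed under functional substitution:
if `H(g⃗,f⃗,x⃗)` and `G₁(f⃗,x⃗,y), …, G_m(f⃗,x⃗,y)` are basic feasible, then so is
`F(f⃗,x⃗) = H(λy.G₁(f⃗,x⃗,y), …, λy.G_m(f⃗,x⃗,y), f⃗, x⃗)`. -/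
theorem bff_closed_under_functional_substitution (k m l : ℕ)
    (H : (Fin (m + k) → ℕ → ℕ) → (Fin l → ℕ) → ℕ)
    (G : Fin m → (Fin k → ℕ → ℕ) → (Fin (l + 1) → ℕ) → ℕ)
    (hH : BFF (m + k) l H) (hG : ∀ i, BFF k (l + 1) (G i)) :
    BFF k l (fun f x =>
      H (Fin.append (fun i => fun y => G i f (Fin.snoc x y)) f) x) := by
  have h := BFF.reindex (BFF.subst_aux hH k l
    (Fin.addCases G (fun j => fun f x => f j (x (Fin.last l)))) (by
      intro i
      refine Fin.addCases (fun j => ?_) (fun j => ?_) i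
      · simpa using hG j
      · have h := BFF.expansion (fun _ : Fin 1 => j) (fun _ : Fin 1 => Fin.last l)
          (fun _ _ _ => Subsingleton.elim _ _) (fun _ _ _ => Subsingleton.elim _ _) BFF.ap
        simpa using h))
    (Fin.addCases id id : Fin (l + l) → Fin l)
  convert h using 3 with f x
  refine congrArg₂ H (funext fun i => ?_) (funext fun j => ?_)
  · refine Fin.addCases (fun j => ?_) (fun j => ?_) i <;> funext y <;> simp
  · simp only [Fin.addCases_right, id]
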